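/- Let X be a Banach space, 1 ≤ p ≤ ∞ with conjugate p', and 0 < q < p'. Let ρ = (ρ_j)_{j≥1} satisfy ρ_min := inf_j ρ_j > 1 and (ρ_j^{-1})_{j≥1} ∈ ℓ_q(ℕ). Set θ := 1 − q/p' ∈ (0,1], κ_j := ρ_j^θ, and q_θ := q/θ. Let (t_μ)_{μ∈F} ⊂ X with ‖(ρ^μ ‖t_μ‖_X)_μ‖_{ℓ_p(F)} < ∞ and suppose u(y) = Σ_μ t_μ y^μ converges absolutely for all y ∈ Y. Then M₁ := Σ_{μ∈F} κ^μ ‖t_μ‖_X < ∞, and for every ȳ ∈ Y, every λ with 0 < λ_j ≤ 1 − |ȳ_j|, every hyperrectangle Q := {y : |y_j − ȳ_j| ≤ λ_j for all j}, and every integer m ≥ 0, there is a set Λ ⊆ F with #Λ = m+1 such that the polynomial P_Q(y) := Σ_{ν∈Λ} s_ν (y−ȳ)^ν, with s_ν := Σ_{μ≥ν} (μ!/((μ−ν)!ν!)) t_μ ȳ^{μ−ν}, satisfies sup_{y∈Q} ‖u(y) − P_Q(y)‖_X ≤ C(κ, q_θ) · M₁ · ‖(κ̃_j^{-1})_{j≥1}‖_{ℓ_{q_θ}(ℕ)}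 · (m+1)^{−r}, where κ̃_j := (ρ_j^θ − |ȳ_j|)/λ_j, r := −1 + 1/p + 1/q, C(κ,q_θ) := β^{1/q_θ} exp((β/q_θ)‖(κ_j^{-1})‖_{ℓ_{q_θ}}^{q_θ}) and β := −ln(1 − κ_min^{−q_θ}) κ_min^{q_θ} with κ_min := ρ_min^θ. -/

import Mathlib

open scoped BigOperators ENNReal

noncomputable section

/-- The set `F` of finitely supported multi-indices. -/
abbrev MIdx : Type := ℕ →₀ ℕ

/-- `ρ^ν := ∏_j ρ_j^{ν_j}` for a finitely supported multi-index `ν`. -/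
def mpow (ρ : ℕ → ℝ) (ν : MIdx) : ℝ := ν.prod fun j k => ρ j ^ k

/-- `μ!/((μ-ν)!ν!) = ∏_j C(μ_j, ν_j)` (meaningful for `ν ≤ μ`). -/
def mchoose (μ ν : MIdx) : ℕ := μ.prod fun j k => k.choose (ν j)

/-- The `ℓ_p(F)` norm (`p ∈ [1,∞]`, valued in `ℝ≥0∞`) of a family of nonnegative reals. -/
def lpF (p : ℝ≥0∞) (a : MIdx → ℝ) : ℝ≥0∞ :=
  if p = ∞ then ⨆ ν, ENNReal.ofReal (a ν)
  else (∑' ν, ENNReal.ofReal (a ν) ^ p.toReal) ^ (1 / p.toReal)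

section MultiIndexPowers

lemma mpow_eq_prod {s : Finset ℕ} (a : ℕ → ℝ) {ν : MIdx} (h : ν.support ⊆ s) :
    mpow a ν = ∏ j ∈ s, a j ^ ν j :=
  Finsupp.prod_of_support_subset ν h _ fun _ _ => pow_zero _

lemma mpow_zero_right (a : ℕ → ℝ) : mpow a 0 = 1 := Finsupp.prod_zero_index

lemma mpow_mul (a b : ℕ → ℝ) (ν : MIdx) :
    mpow (fun j => a j * b j) ν = mpow a ν * mpow b ν := by
  simp only [mpow, Finsupp.prod, mul_pow, Finset.prod_mul_distrib]

lemma abs_mpow (a : ℕ → ℝ) (ν : MIdx) : |mpow a ν| = mpow (fun j => |a j|) ν := by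
  simp only [mpow, Finsupp.prod, Finset.abs_prod, abs_pow]

lemma mpow_nonneg {a : ℕ → ℝ} (ha : ∀ j, 0 ≤ a j) (ν : MIdx) : 0 ≤ mpow a ν :=
  Finset.prod_nonneg fun j _ => pow_nonneg (ha j) _

lemma mpow_pos {a : ℕ → ℝ} (ha : ∀ j, 0 < a j) (ν : MIdx) : 0 < mpow a ν :=
  Finset.prod_pos fun j _ => pow_pos (ha j) _

lemma mpow_le_mpow {a b : ℕ → ℝ} (ha : ∀ j, 0 ≤ a j) (hab : ∀ j, a j ≤ b j) (ν : MIdx) :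
    mpow a ν ≤ mpow b ν :=
  Finset.prod_le_prod (fun j _ => pow_nonneg (ha j) _)
    fun j _ => pow_le_pow_left₀ (ha j) (hab j) _

lemma abs_mpow_le {a b : ℕ → ℝ} (hab : ∀ j, |a j| ≤ b j) (ν : MIdx) : |mpow a ν| ≤ mpow b ν :=
  (abs_mpow a ν).trans_le (mpow_le_mpow (fun _ => abs_nonneg _) hab ν)

lemma mpow_rpow {a : ℕ → ℝ} (ha : ∀ j, 0 ≤ a j) (s : ℝ) (ν : MIdx) :
    mpow (fun j => a j ^ s) ν = mpow a ν ^ s := by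
  simp only [mpow, Finsupp.prod]
  rw [← Real.finsetProd_rpow _ _ fun j _ => pow_nonneg (ha j) _]
  refine Finset.prod_congr rfl fun j _ => ?_
  rw [← Real.rpow_natCast, ← Real.rpow_natCast, ← Real.rpow_mul (ha j), ← Real.rpow_mul (ha j),
    mul_comm]

lemma sum_finsupp_prod_eq (s : Finset ℕ) (T : ℕ → Finset ℕ) (g : ℕ → ℕ → ℝ) :
    ∑ ν ∈ s.finsupp T, ∏ j ∈ s, g j (ν j) = ∏ j ∈ s, ∑ k ∈ T j, g j k := by
  rw [Finset.finsupp, Finset.sum_map, Finset.prod_sum]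
  refine Finset.sum_congr (by congr!) fun f _ => ?_
  rw [← Finset.prod_attach]
  refine Finset.prod_congr rfl fun j _ => ?_
  simp

/-- Partial sums of `∏_j x_j^{ν_j}` are bounded by `exp (∑ y_j)` when
`(1 - x_j)⁻¹ ≤ exp y_j`. -/
lemma sum_mpow_le_exp {x y : ℕ → ℝ} (hx0 : ∀ j, 0 ≤ x j) (hx1 : ∀ j, x j < 1)
    (hxy : ∀ j, -Real.log (1 - x j) ≤ y j) (hy : Summable y) (T : Finset MIdx) :
    ∑ ν ∈ T, mpow x ν ≤ Real.exp (∑' j, y j) := by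
  have hy0 : ∀ j, 0 ≤ y j := fun j => by
    have := Real.log_nonpos (sub_nonneg.2 (hx1 j).le) (by linarith [hx0 j])
    linarith [hxy j]
  set s : Finset ℕ := T.sup Finsupp.support with hs
  set K : ℕ := T.sup fun ν => ν.support.sup ν with hK
  have hsub : ∀ ν ∈ T, ν.support ⊆ s := fun ν hν => Finset.le_sup (f := Finsupp.support) hν
  have hT : T ⊆ s.finsupp fun _ => Finset.range (K + 1) := by
    intro ν hν
    rw [Finset.mem_finsupp_iff]
    refine ⟨hsub ν hν, fun j _ => Finset.mem_range.2 (Nat.lt_succ_of_le ?_)⟩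
    by_cases hj : j ∈ ν.support
    · exact (Finset.le_sup (f := ν) hj).trans
        (Finset.le_sup (f := fun ν : MIdx => ν.support.sup ν) hν)
    · simp [Finsupp.notMem_support_iff.1 hj]
  calc ∑ ν ∈ T, mpow x ν
      ≤ ∑ ν ∈ s.finsupp fun _ => Finset.range (K + 1), mpow x ν :=
        Finset.sum_le_sum_of_subset_of_nonneg hT fun ν _ _ => mpow_nonneg hx0 ν
    _ = ∑ ν ∈ s.finsupp fun _ => Finset.range (K + 1), ∏ j ∈ s, x j ^ ν j :=
        Finset.sum_congr rfl fun ν hν => mpow_eq_prod x (Finset.mem_finsupp_iff.1 hν).1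
    _ = ∏ j ∈ s, ∑ k ∈ Finset.range (K + 1), x j ^ k :=
        sum_finsupp_prod_eq s (fun _ => Finset.range (K + 1)) fun j k => x j ^ k
    _ ≤ ∏ j ∈ s, Real.exp (y j) := by
        refine Finset.prod_le_prod (fun j _ => Finset.sum_nonneg fun k _ => pow_nonneg (hx0 j) k)
          fun j _ => ?_
        have h1 : 0 < 1 - x j := sub_pos.2 (hx1 j)
        calc ∑ k ∈ Finset.range (K + 1), x j ^ k ≤ ∑' k, x j ^ k :=
              (summable_geometric_of_lt_one (hx0 j) (hx1 j)).sum_le_tsum _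
                fun k _ => pow_nonneg (hx0 j) k
          _ = (1 - x j)⁻¹ := tsum_geometric_of_lt_one (hx0 j) (hx1 j)
          _ = Real.exp (-Real.log (1 - x j)) := by rw [Real.exp_neg, Real.exp_log h1]
          _ ≤ Real.exp (y j) := Real.exp_le_exp.2 (hxy j)
    _ = Real.exp (∑ j ∈ s, y j) := (Real.exp_sum s y).symm
    _ ≤ Real.exp (∑' j, y j) := Real.exp_le_exp.2 (hy.sum_le_tsum s fun j _ => hy0 j)

lemma summable_mpow {x y : ℕ → ℝ} (hx0 : ∀ j, 0 ≤ x j) (hx1 : ∀ j, x j < 1)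
    (hxy : ∀ j, -Real.log (1 - x j) ≤ y j) (hy : Summable y) : Summable (mpow x) :=
  summable_of_sum_le (mpow_nonneg hx0) (sum_mpow_le_exp hx0 hx1 hxy hy)

/-- The secant bound for the convex function `x ↦ -log (1 - x)` on `[0, z]`. -/
lemma neg_log_one_sub_le {x z : ℝ} (hx : 0 ≤ x) (hxz : x ≤ z) (hz0 : 0 < z) (hz : z < 1) :
    -Real.log (1 - x) ≤ -Real.log (1 - z) * z⁻¹ * x := by
  have h := strictConcaveOn_log_Ioi.concaveOn.2 (Set.mem_Ioi.2 one_pos)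
    (Set.mem_Ioi.2 (sub_pos.2 hz)) (sub_nonneg.2 ((div_le_one hz0).2 hxz)) (by positivity : 0 ≤ x / z) (sub_add_cancel 1 (x / z))
  have e : (1 - x / z) • (1 : ℝ) + (x / z) • (1 - z) = 1 - x := by
    simp only [smul_eq_mul]; field_simp; ring
  rw [e] at h
  simp only [smul_eq_mul, Real.log_one, mul_zero, zero_add] at h
  have : -Real.log (1 - z) * z⁻¹ * x = -(x / z * Real.log (1 - z)) := by ring
  linarith

end MultiIndexPowers

section Recentering

/-- The coefficient of `b^ν` in the expansion of `(a + b)^μ`. -/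
def recenterCoeff (a : ℕ → ℝ) (μ ν : MIdx) : ℝ :=
  if ν ≤ μ then (mchoose μ ν : ℝ) * mpow a (μ - ν) else 0

lemma recenterCoeff_nonneg {a : ℕ → ℝ} (ha : ∀ j, 0 ≤ a j) (μ ν : MIdx) :
    0 ≤ recenterCoeff a μ ν := by
  unfold recenterCoeff
  split_ifs
  · exact mul_nonneg (Nat.cast_nonneg _) (mpow_nonneg ha _)
  · exact le_rfl

lemma abs_recenterCoeff_le {a A : ℕ → ℝ} (h : ∀ j, |a j| ≤ A j) (μ ν : MIdx) :
    |recenterCoeff a μ ν| ≤ recenterCoeff A μ ν := by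
  unfold recenterCoeff
  split_ifs
  · rw [abs_mul, Nat.abs_cast]
    exact mul_le_mul_of_nonneg_left (abs_mpow_le h _) (Nat.cast_nonneg _)
  · simp

/-- The multi-index binomial theorem. -/
lemma hasSum_recenterCoeff_mul_mpow (a b : ℕ → ℝ) (μ : MIdx) :
    HasSum (fun ν => recenterCoeff a μ ν * mpow b ν) (mpow (fun j => a j + b j) μ) := by
  have hmem : ∀ ν, ν ∈ μ.support.finsupp (fun j => Finset.range (μ j + 1)) ↔ ν ≤ μ := by
    intro ν
    rw [Finset.mem_finsupp_iff]
    constructor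
    · rintro ⟨h1, h2⟩ j
      by_cases hj : j ∈ μ.support
      · exact Nat.le_of_lt_succ (Finset.mem_range.1 (h2 j hj))
      · simp [Finsupp.notMem_support_iff.1 fun h => hj (h1 h)]
    · intro h
      exact ⟨Finsupp.support_mono h, fun j _ => Finset.mem_range.2 (Nat.lt_succ_of_le (h j))⟩
  have hsum : mpow (fun j => a j + b j) μ =
      ∑ ν ∈ μ.support.finsupp (fun j => Finset.range (μ j + 1)),
        recenterCoeff a μ ν * mpow b ν := by
    calc mpow (fun j => a j + b j) μ
        = ∏ j ∈ μ.support, ∑ k ∈ Finset.range (μ j + 1),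
            b j ^ k * a j ^ (μ j - k) * ((μ j).choose k : ℝ) :=
          Finset.prod_congr rfl fun j _ => by
            simp only [add_comm (a j) (b j), add_pow]
      _ = _ := by
          rw [← sum_finsupp_prod_eq]
          refine Finset.sum_congr rfl fun ν hν => ?_
          have hle := (hmem ν).1 hν
          rw [recenterCoeff, if_pos hle, mpow_eq_prod b (Finsupp.support_mono hle),
            mpow_eq_prod a (s := μ.support) (Finsupp.support_mono tsub_le_self), mchoose,
            Finsupp.prod, Nat.cast_prod, ← Finset.prod_mul_distrib, ← Finset.prod_mul_distrib]
          refine Finset.prod_congr rfl fun j _ => ?_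
          rw [Finsupp.tsub_apply]
          ring
  rw [hsum]
  refine hasSum_sum_of_ne_finset_zero fun ν hν => ?_
  rw [recenterCoeff, if_neg fun h => hν ((hmem ν).2 h), zero_mul]

variable {X : Type*} [NormedAddCommGroup X] [NormedSpace ℝ X]

/-- The coefficient of `(y - a)^ν` in the expansion of `∑ t_μ y^μ` around `a`. -/
def taylorCoeff (t : MIdx → X) (a : ℕ → ℝ) (ν : MIdx) : X :=
  ∑' μ, recenterCoeff a μ ν • t μ

lemma taylorCoeff_eq_tsum_subtype (t : MIdx → X) (a : ℕ → ℝ) (ν : MIdx) :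
    taylorCoeff t a ν =
      ∑' μ : {μ : MIdx // ν ≤ μ}, ((mchoose μ.1 ν : ℝ) * mpow a (μ.1 - ν)) • t μ.1 := by
  refine Eq.trans ?_ (tsum_subtype {μ : MIdx | ν ≤ μ} fun μ =>
    ((mchoose μ ν : ℝ) * mpow a (μ - ν)) • t μ).symm
  refine tsum_congr fun μ => ?_
  by_cases h : ν ≤ μ <;> simp [recenterCoeff, h]

lemma summable_recenter_majorant {A B : ℕ → ℝ} {w : MIdx → ℝ} (hA : ∀ j, 0 ≤ A j)
    (hB : ∀ j, 0 ≤ B j) (hw : ∀ μ, 0 ≤ w μ)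
    (h : Summable fun μ => mpow (fun j => A j + B j) μ * w μ) :
    Summable fun x : MIdx × MIdx => recenterCoeff A x.1 x.2 * mpow B x.2 * w x.1 := by
  rw [summable_prod_of_nonneg fun x =>
    mul_nonneg (mul_nonneg (recenterCoeff_nonneg hA _ _) (mpow_nonneg hB _)) (hw _)]
  refine ⟨fun μ => ((hasSum_recenterCoeff_mul_mpow A B μ).mul_right (w μ)).summable, ?_⟩
  exact h.congr fun μ => (((hasSum_recenterCoeff_mul_mpow A B μ).mul_right (w μ)).tsum_eq).symm

lemma norm_recenter_smul_le {a b A B : ℕ → ℝ} (ha : ∀ j, |a j| ≤ A j) (hb : ∀ j, |b j| ≤ B j)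
    (t : MIdx → X) (μ ν : MIdx) :
    ‖(recenterCoeff a μ ν * mpow b ν) • t μ‖ ≤ recenterCoeff A μ ν * mpow B ν * ‖t μ‖ := by
  rw [norm_smul, Real.norm_eq_abs, abs_mul]
  gcongr
  · exact recenterCoeff_nonneg (fun j => (abs_nonneg _).trans (ha j)) _ _
  · exact abs_recenterCoeff_le ha μ ν
  · exact abs_mpow_le hb ν

lemma mpow_smul_taylorCoeff (t : MIdx → X) (a b : ℕ → ℝ) (ν : MIdx) :
    mpow b ν • taylorCoeff t a ν = ∑' μ, (recenterCoeff a μ ν * mpow b ν) • t μ := by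
  rw [taylorCoeff, ← tsum_const_smul'']
  exact tsum_congr fun μ => by rw [smul_smul, mul_comm]

lemma hasSum_mpow_smul_taylorCoeff [CompleteSpace X] {t : MIdx → X} {a b A B : ℕ → ℝ}
    (ha : ∀ j, |a j| ≤ A j) (hb : ∀ j, |b j| ≤ B j)
    (h : Summable fun μ => mpow (fun j => A j + B j) μ * ‖t μ‖) :
    HasSum (fun ν => mpow b ν • taylorCoeff t a ν)
      (∑' μ, mpow (fun j => a j + b j) μ • t μ) := by
  have hF : Summable fun x : MIdx × MIdx => (recenterCoeff a x.1 x.2 * mpow b x.2) • t x.1 :=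
    Summable.of_norm_bounded (summable_recenter_majorant (fun j => (abs_nonneg _).trans (ha j))
      (fun j => (abs_nonneg _).trans (hb j)) (fun _ => norm_nonneg _) h)
      fun x => norm_recenter_smul_le ha hb t x.1 x.2
  have hF' := hF.prod_symm
  have h1 := hF'.prod
  have h2 : ∑' ν, ∑' μ, (recenterCoeff a μ ν * mpow b ν) • t μ =
      ∑' μ, ∑' ν, (recenterCoeff a μ ν * mpow b ν) • t μ :=
    Summable.tsum_comm (f := fun μ ν => (recenterCoeff a μ ν * mpow b ν) • t μ) hF
  simp only [Prod.fst_swap, Prod.snd_swap] at h1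
  have h3 := h1.hasSum
  rw [h2] at h3
  simp only [← mpow_smul_taylorCoeff] at h3
  convert h3 using 1
  exact tsum_congr fun μ =>
    (((hasSum_recenterCoeff_mul_mpow a b μ).smul_const (t μ)).tsum_eq).symm

lemma summable_mpow_mul_norm_taylorCoeff {t : MIdx → X} {a A B : ℕ → ℝ}
    (ha : ∀ j, |a j| ≤ A j) (hB : ∀ j, 0 ≤ B j)
    (h : Summable fun μ => mpow (fun j => A j + B j) μ * ‖t μ‖) :
    Summable (fun ν => mpow B ν * ‖taylorCoeff t a ν‖) ∧
      ∑' ν, mpow B ν * ‖taylorCoeff t a ν‖ ≤ ∑' μ, mpow (fun j => A j + B j) μ * ‖t μ‖ := by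
  have hA : ∀ j, 0 ≤ A j := fun j => (abs_nonneg _).trans (ha j)
  have hG := summable_recenter_majorant hA hB (fun μ => norm_nonneg (t μ)) h
  have hG1 := hG.prod_symm.prod
  simp only [Prod.fst_swap, Prod.snd_swap] at hG1
  have hle : ∀ ν, mpow B ν * ‖taylorCoeff t a ν‖ ≤
      ∑' μ, recenterCoeff A μ ν * mpow B ν * ‖t μ‖ := by
    intro ν
    rw [← abs_of_nonneg (mpow_nonneg hB ν), ← Real.norm_eq_abs, ← norm_smul,
      mpow_smul_taylorCoeff, Real.norm_eq_abs, abs_of_nonneg (mpow_nonneg hB ν)]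
    exact tsum_of_norm_bounded (hG.prod_symm.prod_factor ν).hasSum fun μ =>
      norm_recenter_smul_le ha (fun j => (abs_of_nonneg (hB j)).le) t μ ν
  have hs := hG1.of_nonneg_of_le (fun ν => mul_nonneg (mpow_nonneg hB ν) (norm_nonneg _)) hle
  refine ⟨hs, (hs.tsum_le_tsum hle hG1).trans_eq ?_⟩
  rw [Summable.tsum_comm (f := fun μ ν => recenterCoeff A μ ν * mpow B ν * ‖t μ‖) hG]
  exact tsum_congr fun μ =>
    ((hasSum_recenterCoeff_mul_mpow A B μ).mul_right ‖t μ‖).tsum_eq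

end Recentering

section BestTerms

/-- In a summable positive family one can choose `n` terms such that each remaining term is at most
`1 / (n + 1)` times the total. -/
lemma exists_finset_card_eq_forall_notMem_mul_le {ι : Type*} [Infinite ι] {x : ι → ℝ}
    (hx0 : ∀ i, 0 < x i) (hx : Summable x) (n : ℕ) :
    ∃ Λ : Finset ι, Λ.card = n ∧ ∀ i ∉ Λ, ((n : ℝ) + 1) * x i ≤ ∑' j, x j := by
  classical
  have key : ∃ Λ : Finset ι, Λ.card = n ∧ ∀ j ∈ Λ, ∀ i ∉ Λ, x i ≤ x j := by
    induction n with
    | zero => exact ⟨∅, rfl, by simp⟩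
    | succ n ih =>
      obtain ⟨Λ, hc, hΛ⟩ := ih
      have hlim : Filter.Tendsto (fun i => (x i)⁻¹) Filter.cofinite Filter.atTop :=
        Filter.Tendsto.inv_tendsto_nhdsGT_zero (tendsto_nhdsWithin_iff.2
          ⟨hx.tendsto_cofinite_zero, Filter.Eventually.of_forall hx0⟩)
      obtain ⟨i₀, hi₀, hmax⟩ :=
        hlim.exists_within_forall_le (s := {i | i ∉ Λ}) (Infinite.exists_notMem_finset Λ)
      refine ⟨insert i₀ Λ, by rw [Finset.card_insert_of_notMem hi₀, hc], fun j hj i hi => ?_⟩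
      rw [Finset.mem_insert, not_or] at hi
      rcases Finset.mem_insert.1 hj with rfl | hj
      · exact (inv_le_inv₀ (hx0 j) (hx0 i)).1 (hmax i hi.2)
      · exact hΛ j hj i hi.2
  obtain ⟨Λ, hc, hΛ⟩ := key
  refine ⟨Λ, hc, fun i hi => ?_⟩
  calc ((n : ℝ) + 1) * x i = ∑ _j ∈ insert i Λ, x i := by
        rw [Finset.sum_const, Finset.card_insert_of_notMem hi, hc, nsmul_eq_mul]; push_cast; ring
    _ ≤ ∑ j ∈ insert i Λ, x j := Finset.sum_le_sum fun j hj => by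
        rcases Finset.mem_insert.1 hj with rfl | hj
        · exact le_rfl
        · exact hΛ j hj i hi
    _ ≤ ∑' j, x j := hx.sum_le_tsum _ fun j _ => (hx0 j).le

/-- Variant for multi-indices in which the index `0` is always selected and does not contribute to
the total. -/
lemma exists_finset_mpow_le {x : ℕ → ℝ} (hx0 : ∀ j, 0 < x j) (hx : Summable (mpow x)) (m : ℕ) :
    ∃ Λ : Finset MIdx, Λ.card = m + 1 ∧
      ∀ ν ∉ Λ, ((m : ℝ) + 1) * mpow x ν ≤ ∑' μ, mpow x μ - 1 := by
  classical
  have : Infinite {ν : MIdx // ν ∉ ({0} : Finset MIdx)} :=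
    (Set.Finite.infinite_compl (Finset.finite_toSet ({0} : Finset MIdx))).to_subtype
  obtain ⟨Λ, hc, hΛ⟩ := exists_finset_card_eq_forall_notMem_mul_le
    (x := fun ν : {ν : MIdx // ν ∉ ({0} : Finset MIdx)} => mpow x ν)
    (fun ν => mpow_pos hx0 ν) (hx.subtype _) m
  have h0 : (0 : MIdx) ∉ Λ.map (Function.Embedding.subtype _) := by simp
  refine ⟨insert 0 (Λ.map (Function.Embedding.subtype _)), ?_, fun ν hν => ?_⟩
  · rw [Finset.card_insert_of_notMem h0, Finset.card_map, hc]
  · rw [Finset.mem_insert, not_or] at hν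
    have hν0 : ν ∉ ({0} : Finset MIdx) := by simpa using hν.1
    have h := hΛ ⟨ν, hν0⟩ fun h => hν.2 (Finset.mem_map_of_mem _ h)
    have hs := hx.sum_add_tsum_subtype_compl {0}
    rw [Finset.sum_singleton, mpow_zero_right] at hs
    linarith

lemma norm_sub_sum_le_of_forall_notMem {ι X : Type*} [NormedAddCommGroup X] [CompleteSpace X]
    {f : ι → X} {u : X} {g : ι → ℝ} {ε : ℝ} {Λ : Finset ι} (hf : HasSum f u) (hε : 0 ≤ ε)
    (hg0 : ∀ i, 0 ≤ g i) (hg : Summable g) (h : ∀ i ∉ Λ, ‖f i‖ ≤ ε * g i) :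
    ‖u - ∑ i ∈ Λ, f i‖ ≤ ε * ∑' i, g i := by
  have e : u - ∑ i ∈ Λ, f i = ∑' i : {i // i ∉ Λ}, f i := by
    rw [← hf.tsum_eq, ← hf.summable.sum_add_tsum_subtype_compl Λ, add_sub_cancel_left]
  rw [e]
  refine (tsum_of_norm_bounded ((hg.subtype fun i => i ∉ Λ).hasSum.mul_left ε)
    fun i => h i.1 i.2).trans (mul_le_mul_of_nonneg_left ?_ hε)
  exact Summable.tsum_subtype_le g {i | i ∉ Λ} hg0 hg

end BestTerms

section WeightedSummability

lemma lpF_top_ne_top {a : MIdx → ℝ} (h : lpF ∞ a ≠ ∞) : ∃ B, ∀ ν, a ν ≤ B := by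
  rw [lpF, if_pos rfl] at h
  refine ⟨(⨆ ν, ENNReal.ofReal (a ν)).toReal, fun ν => ?_⟩
  exact (ENNReal.ofReal_le_iff_le_toReal h).1 (le_iSup (fun ν => ENNReal.ofReal (a ν)) ν)

lemma summable_rpow_of_lpF_ne_top {p : ℝ≥0∞} (hp : p ≠ ∞) (hp0 : 0 < p.toReal) {a : MIdx → ℝ}
    (ha : ∀ ν, 0 ≤ a ν) (h : lpF p a ≠ ∞) : Summable fun ν => a ν ^ p.toReal := by
  rw [lpF, if_neg hp] at h
  have h' : ∑' ν, ENNReal.ofReal (a ν) ^ p.toReal ≠ ∞ := by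
    intro h'
    rw [h', ENNReal.top_rpow_of_pos (by positivity)] at h
    exact h rfl
  refine (ENNReal.summable_toReal h').congr fun ν => ?_
  rw [← ENNReal.toReal_rpow, ENNReal.toReal_ofReal (ha ν)]

lemma summable_mpow_rpow_mul {p : ℝ≥0∞} (hp : 1 ≤ p) {q : ℝ} {ρ : ℕ → ℝ} (hρ : ∀ j, 0 < ρ j)
    (hV : Summable (mpow fun j => (ρ j)⁻¹ ^ q)) {w : MIdx → ℝ} (hw : ∀ μ, 0 ≤ w μ)
    (hM : lpF p (fun μ => mpow ρ μ * w μ) ≠ ∞) :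
    Summable fun μ => mpow (fun j => ρ j ^ (1 - q * (1 - 1 / p.toReal))) μ * w μ := by
  have hVeq : ∀ μ, mpow (fun j => (ρ j)⁻¹ ^ q) μ = mpow ρ μ ^ (-q) := fun μ => by
    rw [← mpow_rpow fun j => (hρ j).le]
    simp only [Real.inv_rpow (hρ _).le, Real.rpow_neg (hρ _).le]
  have hpos := mpow_pos hρ
  have ha : ∀ μ, 0 ≤ mpow ρ μ * w μ := fun μ => mul_nonneg (hpos μ).le (hw μ)
  have heq : ∀ μ, mpow ρ μ * w μ * mpow (fun j => (ρ j)⁻¹ ^ q) μ ^ (1 - 1 / p.toReal) =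
      mpow (fun j => ρ j ^ (1 - q * (1 - 1 / p.toReal))) μ * w μ := fun μ => by
    rw [hVeq, mpow_rpow fun j => (hρ j).le, ← Real.rpow_mul (hpos μ).le, sub_eq_add_neg 1 (q * _),
      Real.rpow_add (hpos μ), Real.rpow_one, neg_mul]
    ring
  refine Summable.congr ?_ heq
  have hV0 : ∀ μ, 0 ≤ mpow (fun j => (ρ j)⁻¹ ^ q) μ := fun μ => by
    rw [hVeq]; exact Real.rpow_nonneg (hpos μ).le _
  rcases eq_or_ne p ∞ with rfl | hp'
  · obtain ⟨B, hB⟩ := lpF_top_ne_top hM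
    simp only [ENNReal.toReal_top, div_zero, sub_zero, Real.rpow_one]
    exact (hV.mul_left B).of_nonneg_of_le (fun μ => mul_nonneg (ha μ) (hV0 μ))
      fun μ => mul_le_mul_of_nonneg_right (hB μ) (hV0 μ)
  · have hp1 : 1 ≤ p.toReal := by simpa using ENNReal.toReal_mono hp' hp
    have hs := summable_rpow_of_lpF_ne_top hp' (by linarith) ha hM
    rcases hp1.eq_or_lt with h1 | h1
    · simpa [← h1] using hs
    · refine Real.summable_mul_of_Lp_Lq_of_nonneg (Real.HolderConjugate.conjExponent h1) ha
        (fun μ => Real.rpow_nonneg (hV0 μ) _) hs (hV.congr fun μ => ?_)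
      have hp2 : p.toReal - 1 ≠ 0 := by linarith
      have hp3 : p.toReal ≠ 0 := by linarith
      rw [← Real.rpow_mul (hV0 μ), Real.conjExponent]
      have : (1 - 1 / p.toReal) * (p.toReal / (p.toReal - 1)) = 1 := by field_simp
      rw [this, Real.rpow_one]

end WeightedSummability

/-- Local Taylor approximation error estimate via the modified sequence
`κ_j = ρ_j^θ`, `θ = 1 - q/p'`, `q_θ = q/θ` (Theorem `local_v2`): `u ∈ B_{ρ,p}` implies
`M₁ = Σ_μ κ^μ ‖t_μ‖ < ∞`, and on each hyperrectangle `Q ⊆ Y` there is a set `Λ` with `m+1`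
terms such that `sup_{y∈Q} ‖u(y) − P_Q(y)‖ ≤ C(κ,q_θ) M₁ ‖(κ̃_j^{-1})‖_{ℓ_{q_θ}} (m+1)^{-r}`,
`κ̃_j = (ρ_j^θ - |ȳ_j|)/λ_j`. Here `1/p' = 1 - 1/p.toReal`, and the condition
`0 < q < p'` is encoded by `0 < q` together with `0 < r`. -/
theorem local_taylor_error_v2
    {X : Type*} [NormedAddCommGroup X] [NormedSpace ℝ X] [CompleteSpace X]
    (p : ℝ≥0∞) (hp : 1 ≤ p)
    (q : ℝ) (hq : 0 < q)
    (r : ℝ) (hrdef : r = -1 + 1 / p.toReal + 1 / q) (hr : 0 < r)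
    (ρ : ℕ → ℝ) (ρmin : ℝ) (hρmin : ρmin = ⨅ j, ρ j) (hmin : 1 < ρmin)
    (hρq : Summable fun j => ((ρ j)⁻¹) ^ q)
    (θ : ℝ) (hθ : θ = 1 - q * (1 - 1 / p.toReal))
    (κ : ℕ → ℝ) (hκ : ∀ j, κ j = ρ j ^ θ)
    (qθ : ℝ) (hqθ : qθ = q / θ)
    (κmin : ℝ) (hκmin : κmin = ρmin ^ θ)
    (β : ℝ) (hβ : β = -Real.log (1 - κmin ^ (-qθ)) * κmin ^ qθ)
    (C : ℝ) (hC : C = β ^ (1 / qθ) * Real.exp (β / qθ * ∑' j, ((κ j)⁻¹) ^ qθ))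
    (t : MIdx → X)
    (hM : lpF p (fun μ => mpow ρ μ * ‖t μ‖) ≠ ∞)
    (habs : ∀ y : ℕ → ℝ, (∀ j, |y j| ≤ 1) →
      Summable fun μ : MIdx => ‖mpow y μ • t μ‖) :
    Summable (fun μ : MIdx => mpow κ μ * ‖t μ‖) ∧
    ∀ ybar lam : ℕ → ℝ, (∀ j, |ybar j| ≤ 1) →
      (∀ j, 0 < lam j ∧ lam j ≤ 1 - |ybar j|) →
      ∀ m : ℕ, ∃ Λ : Finset MIdx, Λ.card = m + 1 ∧
        ∀ y : ℕ → ℝ, (∀ j, |y j - ybar j| ≤ lam j) →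
          ‖(∑' μ : MIdx, mpow y μ • t μ) -
              ∑ ν ∈ Λ, mpow (fun j => y j - ybar j) ν •
                (∑' μ : {μ : MIdx // ν ≤ μ},
                  ((mchoose μ.1 ν : ℝ) * mpow ybar (μ.1 - ν)) • t μ.1)‖ ≤
            C * (∑' μ : MIdx, mpow κ μ * ‖t μ‖) *
              (∑' j, (((ρ j ^ θ - |ybar j|) / lam j)⁻¹) ^ qθ) ^ (1 / qθ) *
              ((m : ℝ) + 1) ^ (-r) := by
  have hρ1 : ∀ j, ρmin ≤ ρ j := fun j => by
    have hbdd : BddBelow (Set.range ρ) := by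
      by_contra hb
      rw [iInf, Real.sInf_of_not_bddBelow hb] at hρmin
      linarith
    exact hρmin ▸ ciInf_le hbdd j
  have hρ0 : ∀ j, 0 < ρ j := fun j => by linarith [hρ1 j]
  have hθr : θ = q * r := by rw [hθ, hrdef]; field_simp; ring
  have hθ0 : 0 < θ := hθr ▸ mul_pos hq hr
  have hqr : 1 / qθ = r := by rw [hqθ, hθr]; field_simp
  have hqθ0 : 0 < qθ := by rw [hqθ]; positivity
  have hθq : θ * qθ = q := by rw [hqθ]; field_simp
  have hκρ : ∀ j, (κ j)⁻¹ ^ qθ = (ρ j)⁻¹ ^ q := fun j => by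
    rw [hκ, ← Real.inv_rpow (hρ0 j).le, ← Real.rpow_mul (inv_nonneg.2 (hρ0 j).le), hθq]
  have hκ1 : ∀ j, 1 < κ j := fun j => by
    rw [hκ]; exact Real.one_lt_rpow (by linarith [hρ1 j]) hθ0
  set z : ℝ := κmin ^ (-qθ) with hz
  have hκmin1 : 1 < κmin := by rw [hκmin]; exact Real.one_lt_rpow hmin hθ0
  have hz0 : 0 < z := Real.rpow_pos_of_pos (by linarith) _
  have hz1 : z < 1 := Real.rpow_lt_one_of_one_lt_of_neg hκmin1 (neg_neg_of_pos hqθ0)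
  have hβz : β = -Real.log (1 - z) * z⁻¹ := by
    rw [hβ, hz, Real.rpow_neg (by linarith : 0 ≤ κmin), inv_inv]
  have hβ0 : 0 < β := by
    rw [hβz]
    exact mul_pos (neg_pos.2 (Real.log_neg (by linarith) (by linarith))) (inv_pos.2 hz0)
  have hxz : ∀ j, (κ j)⁻¹ ^ qθ ≤ z := fun j => by
    rw [hz, Real.rpow_neg (by linarith : 0 ≤ κmin), ← Real.inv_rpow (by linarith : 0 ≤ κmin)]
    refine Real.rpow_le_rpow (inv_nonneg.2 (by linarith [hκ1 j]))
      (inv_anti₀ (by linarith) ?_) hqθ0.le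
    rw [hκmin, hκ]
    exact Real.rpow_le_rpow (by linarith) (hρ1 j) hθ0.le
  have hκs : Summable fun j => (κ j)⁻¹ ^ qθ := hρq.congr fun j => (hκρ j).symm
  have hlog : ∀ x : ℝ, 0 ≤ x → x ≤ z → -Real.log (1 - x) ≤ β * x := fun x h0 h1 => by
    rw [hβz]; exact neg_log_one_sub_le h0 h1 hz0 hz1
  have hκ0 : ∀ j, 0 ≤ (κ j)⁻¹ ^ qθ := fun j =>
    Real.rpow_nonneg (inv_nonneg.2 (by linarith [hκ1 j])) _
  have hV : Summable (mpow fun j => (ρ j)⁻¹ ^ q) := by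
    simp only [← hκρ]
    exact summable_mpow hκ0 (fun j => (hxz j).trans_lt hz1)
      (fun j => hlog _ (hκ0 j) (hxz j)) (hκs.mul_left β)
  have hM₁ : Summable fun μ : MIdx => mpow κ μ * ‖t μ‖ := by
    rw [funext hκ, hθ]
    exact summable_mpow_rpow_mul hp hρ0 hV (fun μ => norm_nonneg _) hM
  refine ⟨hM₁, fun ybar lam hyb hlam m => ?_⟩
  simp only [← hκ]
  have hB : ∀ j, lam j ≤ κ j - |ybar j| := fun j => by linarith [(hlam j).2, hκ1 j]
  have hB0 : ∀ j, 0 < κ j - |ybar j| := fun j => (hlam j).1.trans_le (hB j)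
  have hk0 : ∀ j, 0 < ((κ j - |ybar j|) / lam j)⁻¹ := fun j =>
    inv_pos.2 (div_pos (hB0 j) (hlam j).1)
  have hkκ : ∀ j, ((κ j - |ybar j|) / lam j)⁻¹ ≤ (κ j)⁻¹ := fun j => by
    refine inv_anti₀ (by linarith [hκ1 j]) ((le_div_iff₀ (hlam j).1).2 ?_)
    have := mul_le_mul_of_nonneg_left (hlam j).2 (by linarith [hκ1 j] : 0 ≤ κ j)
    nlinarith [abs_nonneg (ybar j), hκ1 j]
  set k : ℕ → ℝ := fun j => ((κ j - |ybar j|) / lam j)⁻¹ with hk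
  have hx0 : ∀ j, 0 < k j ^ qθ := fun j => Real.rpow_pos_of_pos (hk0 j) _
  have hxκ : ∀ j, k j ^ qθ ≤ (κ j)⁻¹ ^ qθ := fun j =>
    Real.rpow_le_rpow (hk0 j).le (hkκ j) hqθ0.le
  have hxs : Summable fun j => k j ^ qθ := hκs.of_nonneg_of_le (fun j => (hx0 j).le) hxκ
  set S : ℝ := ∑' j, k j ^ qθ with hS
  have hS0 : 0 ≤ S := tsum_nonneg fun j => (hx0 j).le
  have hx1 : ∀ j, k j ^ qθ < 1 := fun j => ((hxκ j).trans (hxz j)).trans_lt hz1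
  have hxl : ∀ j, -Real.log (1 - k j ^ qθ) ≤ β * k j ^ qθ := fun j =>
    hlog _ (hx0 j).le ((hxκ j).trans (hxz j))
  have hxm : Summable (mpow fun j => k j ^ qθ) :=
    summable_mpow (fun j => (hx0 j).le) hx1 hxl (hxs.mul_left β)
  have htot : ∑' μ, mpow (fun j => k j ^ qθ) μ ≤ Real.exp (β * S) := by
    refine hxm.tsum_le_of_sum_le fun T => ?_
    rw [hS, ← tsum_mul_left]
    exact sum_mpow_le_exp (fun j => (hx0 j).le) hx1 hxl (hxs.mul_left β) T
  obtain ⟨Λ, hcard, hΛ⟩ := exists_finset_mpow_le hx0 hxm m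
  set K : ℝ := ∑' j, (κ j)⁻¹ ^ qθ
  have hSK : S ≤ K := hxs.tsum_le_tsum hxκ hκs
  have hexp : Real.exp (β * S) - 1 ≤ β * S * Real.exp (β * K) := by
    have h1 : 1 - β * S ≤ Real.exp (-(β * S)) := by
      linarith [Real.add_one_le_exp (-(β * S))]
    have h2 := mul_le_mul_of_nonneg_right h1 (Real.exp_pos (β * S)).le
    rw [← Real.exp_add, neg_add_cancel, Real.exp_zero] at h2
    have h3 : β * S * Real.exp (β * S) ≤ β * S * Real.exp (β * K) := by gcongr
    linarith
  have hm0 : (0 : ℝ) < (m : ℝ) + 1 := by positivity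
  have hε : ∀ ν ∉ Λ, mpow k ν ≤ C * S ^ (1 / qθ) * ((m : ℝ) + 1) ^ (-r) := fun ν hν => by
    have h1 : mpow k ν ^ qθ ≤ β * S * Real.exp (β * K) / ((m : ℝ) + 1) := by
      rw [le_div_iff₀ hm0, mul_comm, ← mpow_rpow fun j => (hk0 j).le]
      linarith [hΛ ν hν]
    have h2 := Real.rpow_le_rpow (Real.rpow_nonneg (mpow_nonneg (fun j => (hk0 j).le) ν) _) h1
      (one_div_pos.2 hqθ0).le
    rw [← Real.rpow_mul (mpow_nonneg (fun j => (hk0 j).le) ν), mul_one_div_cancel hqθ0.ne',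
      Real.rpow_one, Real.div_rpow (by positivity) hm0.le, Real.mul_rpow (by positivity)
      (Real.exp_pos _).le, Real.mul_rpow hβ0.le hS0, ← Real.exp_mul] at h2
    refine h2.trans_eq ?_
    rw [hC, Real.rpow_neg hm0.le, ← hqr, show β * K * (1 / qθ) = β / qθ * K by ring]
    ring
  have hC0 : 0 ≤ C := by rw [hC]; positivity
  refine ⟨Λ, hcard, fun y hy => ?_⟩
  have hadd : (fun j => |ybar j| + (κ j - |ybar j|)) = κ := funext fun j => by ring
  have hsum : Summable fun μ => mpow (fun j => |ybar j| + (κ j - |ybar j|)) μ * ‖t μ‖ := by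
    rwa [hadd]
  have hT := hasSum_mpow_smul_taylorCoeff (t := t) (a := ybar) (b := fun j => y j - ybar j)
    (fun _ => le_rfl) (fun j => (hy j).trans (hB j)) hsum
  obtain ⟨hs, hle⟩ := summable_mpow_mul_norm_taylorCoeff (t := t) (a := ybar)
    (fun _ => le_rfl) (fun j => (hB0 j).le) hsum
  simp only [add_sub_cancel] at hT hle
  simp only [← taylorCoeff_eq_tsum_subtype]
  have hε0 : 0 ≤ C * S ^ (1 / qθ) * ((m : ℝ) + 1) ^ (-r) := by positivity
  refine (norm_sub_sum_le_of_forall_notMem hT hε0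
    (fun ν => mul_nonneg (mpow_nonneg (fun j => (hB0 j).le) ν) (norm_nonneg _)) hs
    fun ν hν => ?_).trans ((mul_le_mul_of_nonneg_left hle hε0).trans_eq (by ring))
  have hlamk : lam = fun j => k j * (κ j - |ybar j|) := funext fun j => by
    have := (hB0 j).ne'
    simp only [hk, inv_div]
    field_simp
  calc ‖mpow (fun j => y j - ybar j) ν • taylorCoeff t ybar ν‖
      ≤ mpow lam ν * ‖taylorCoeff t ybar ν‖ := by
        rw [norm_smul]
        exact mul_le_mul_of_nonneg_right (abs_mpow_le hy ν) (norm_nonneg _)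
    _ = mpow k ν * (mpow (fun j => κ j - |ybar j|) ν * ‖taylorCoeff t ybar ν‖) := by
        rw [hlamk, mpow_mul, mul_assoc]
    _ ≤ _ := mul_le_mul_of_nonneg_right (hε ν hν)
        (mul_nonneg (mpow_nonneg (fun j => (hB0 j).le) ν) (norm_nonneg _))
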